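/- (Monotonicity of perimeter, hyperbolic case.) Let K and L be compact geodesically convex subsets of the hyperbolic plane H² (of constant curvature −1) with nonempty interiors such that K ⊆ L. Then P_K ≤ P_L. -/

import Mathlib

open MeasureTheory Metric Real UpperHalfPlane

open scoped UpperHalfPlane

noncomputable section

instance : MeasurableSpace ℍ := borel ℍ

instance : BorelSpace ℍ := ⟨rfl⟩

/-- The hyperbolic area measure on the upper half-plane: the measure with density
`y⁻²` with respect to the planar Lebesgue measure. -/
def hypAreaMeasure : Measure ℍ :=
  (Measure.comap (fun z : ℍ => (z : ℂ)) volume).withDensity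
    (fun z => ENNReal.ofReal ((z.im ^ 2)⁻¹))

/-- The hyperbolic area of a subset of the hyperbolic plane. -/
def hypArea (K : Set ℍ) : ℝ := (hypAreaMeasure K).toReal

/-- The hyperbolic perimeter: one-dimensional Hausdorff measure (with respect to the
hyperbolic metric) of the topological boundary. -/
def hypPerim (K : Set ℍ) : ℝ := (μH[1] (frontier K)).toReal

/-- Geodesic convexity in the hyperbolic plane. -/
def HypConvex (K : Set ℍ) : Prop :=
  ∀ x ∈ K, ∀ y ∈ K, ∀ z : ℍ, dist x z + dist z y = dist x y → z ∈ K

/-- The hyperbolic circumradius of `K`. -/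
def hypCircumradius (K : Set ℍ) : ℝ :=
  sInf {R : ℝ | ∃ c : ℍ, K ⊆ Metric.closedBall c R}

/-- The hyperbolic inradius of `K`. -/
def hypInradius (K : Set ℍ) : ℝ :=
  sSup {r : ℝ | ∃ c : ℍ, Metric.closedBall c r ⊆ K}

/-- `K` is a closed hyperbolic disc of positive radius. -/
def IsHypDisc (K : Set ℍ) : Prop :=
  ∃ (c : ℍ) (r : ℝ), 0 < r ∧ K = Metric.closedBall c r

end

noncomputable section

namespace HypProj

/-- Light-cone coordinates of the hyperboloid model. -/
def ea (z : ℍ) : ℝ := 1 / z.im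
/-- Light-cone coordinates of the hyperboloid model. -/
def eb (z : ℍ) : ℝ := (z.re ^ 2 + z.im ^ 2) / z.im
/-- Light-cone coordinates of the hyperboloid model. -/
def ec (z : ℍ) : ℝ := z.re / z.im

lemma ea_pos (z : ℍ) : 0 < ea z := by
  have := z.im_pos
  unfold ea; positivity

lemma e_norm (z : ℍ) : ea z * eb z - ec z ^ 2 = 1 := by
  have := z.im_pos.ne'
  unfold ea eb ec; field_simp; ring

lemma cosh_eq (z w : ℍ) :
    cosh (dist z w) = (ea z * eb w + eb z * ea w) / 2 - ec z * ec w := by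
  have := z.im_pos.ne'
  have := w.im_pos.ne'
  rw [UpperHalfPlane.cosh_dist']
  unfold ea eb ec; field_simp; ring

lemma exists_geod (p q : ℍ) (hne : p ≠ q) :
    ∃ r : ℝ → ℍ, Continuous r ∧ ∀ t w, sinh (dist p q) * cosh (dist (r t) w) =
      sinh (dist p q - t) * cosh (dist p w) + sinh t * cosh (dist q w) := by
  have hD : 0 < dist p q := dist_pos.2 hne
  have hC := cosh_eq p q
  set D := dist p q with hDdef
  have hS : 0 < sinh D := Real.sinh_pos_iff.2 hD
  set va : ℝ → ℝ := fun t => (sinh (D - t) * ea p + sinh t * ea q) / sinh D with hva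
  set vb : ℝ → ℝ := fun t => (sinh (D - t) * eb p + sinh t * eb q) / sinh D with hvb
  set vc : ℝ → ℝ := fun t => (sinh (D - t) * ec p + sinh t * ec q) / sinh D with hvc
  have hp := e_norm p
  have hq := e_norm q
  have hnorm : ∀ t, va t * vb t - vc t ^ 2 = 1 := by
    intro t
    have h1 : va t * vb t - vc t ^ 2 = (sinh (D - t) ^ 2 * (ea p * eb p - ec p ^ 2)
        + sinh t ^ 2 * (ea q * eb q - ec q ^ 2)
        + 2 * sinh (D - t) * sinh t * ((ea p * eb q + eb p * ea q) / 2 - ec p * ec q))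
          / sinh D ^ 2 := by
      simp only [hva, hvb, hvc]; field_simp; ring
    rw [h1, hp, hq, ← hC, div_eq_one_iff_eq (by positivity), Real.sinh_sub]
    have h2 := Real.cosh_sq t
    have h3 := Real.cosh_sq D
    linear_combination (sinh D ^ 2) * h2 - sinh t ^ 2 * h3
  have hBp : ∀ t, (va t * eb p + vb t * ea p) / 2 - vc t * ec p = cosh t := by
    intro t
    have h1 : (va t * eb p + vb t * ea p) / 2 - vc t * ec p =
        (sinh (D - t) * (ea p * eb p - ec p ^ 2)
        + sinh t * ((ea p * eb q + eb p * ea q) / 2 - ec p * ec q)) / sinh D := by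
      simp only [hva, hvb, hvc]; field_simp; ring
    rw [h1, hp, ← hC, div_eq_iff hS.ne', Real.sinh_sub]
    ring
  have hpos : ∀ t, 0 < va t := by
    intro t
    have h1 : 0 < va t * ea p := by
      have h2 : 2 * (va t * ea p) * cosh t =
          va t ^ 2 + ea p ^ 2 + (va t * ec p - ea p * vc t) ^ 2 := by
        rw [← hBp t]
        linear_combination va t ^ 2 * hp + ea p ^ 2 * hnorm t
      have h3 : 0 < 2 * (va t * ea p) * cosh t := by
        have := ea_pos p
        rw [h2]; positivity
      have h4 := Real.cosh_pos t
      have h5 := pos_of_mul_pos_left h3 h4.le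
      linarith
    exact pos_of_mul_pos_left h1 (ea_pos p).le
  refine ⟨fun t => UpperHalfPlane.mk ⟨vc t / va t, 1 / va t⟩ (by simpa using hpos t), ?_, ?_⟩
  · rw [UpperHalfPlane.isEmbedding_coe.continuous_iff]
    have hac : Continuous va := by simp only [hva]; fun_prop
    have hcc : Continuous vc := by simp only [hvc]; fun_prop
    have : (fun t => (⟨vc t / va t, 1 / va t⟩ : ℂ)) =
      fun t => ((vc t / va t : ℝ) : ℂ) + ((1 / va t : ℝ) : ℂ) * Complex.I := by
      funext t
      apply Complex.ext
      · simp [-Complex.ofReal_div]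
      · simp [-Complex.ofReal_div]
    change Continuous (fun t => (⟨vc t / va t, 1 / va t⟩ : ℂ))
    rw [this]
    have h1 : Continuous fun t => vc t / va t := hcc.div hac fun t => (hpos t).ne'
    have h2 : Continuous fun t => 1 / va t := continuous_const.div hac fun t => (hpos t).ne'
    fun_prop
  · intro t w
    have h0 := (hpos t).ne'
    rw [cosh_eq, cosh_eq, cosh_eq]
    set z : ℍ := UpperHalfPlane.mk ⟨vc t / va t, 1 / va t⟩ (by simpa using hpos t) with hz
    have e1 : ea z = va t := by
      simp [ea, hz, UpperHalfPlane.im]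
    have e3 : ec z = vc t := by
      simp [ec, hz, UpperHalfPlane.im, UpperHalfPlane.re]; field_simp
    have e2 : eb z = vb t := by
      have h1 := e_norm z
      rw [e1, e3] at h1
      have h2 := hnorm t
      exact mul_left_cancel₀ h0 (by linarith)
    rw [e1, e2, e3]
    simp only [hva, hvb, hvc]; field_simp; ring

lemma cosh_inj_nonneg {a b : ℝ} (ha : 0 ≤ a) (hb : 0 ≤ b) (h : cosh a = cosh b) : a = b := by
  have := Real.cosh_le_cosh.1 h.le
  have := Real.cosh_le_cosh.1 h.ge
  rw [abs_of_nonneg ha, abs_of_nonneg hb] at *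
  linarith

lemma geod_dist_left {p q : ℍ} (hne : p ≠ q) {z : ℍ} {t : ℝ} (ht : 0 ≤ t)
    (h : ∀ w, sinh (dist p q) * cosh (dist z w) =
      sinh (dist p q - t) * cosh (dist p w) + sinh t * cosh (dist q w)) : dist p z = t := by
  have hS : 0 < sinh (dist p q) := Real.sinh_pos_iff.2 (dist_pos.2 hne)
  refine cosh_inj_nonneg dist_nonneg ht ?_
  have h1 := h p
  rw [dist_self, cosh_zero, dist_comm q p, Real.sinh_sub, dist_comm z p] at h1
  refine mul_left_cancel₀ hS.ne' ?_
  rw [h1]; ring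

lemma geod_dist_right {p q : ℍ} (hne : p ≠ q) {z : ℍ} {t : ℝ} (ht : t ≤ dist p q)
    (h : ∀ w, sinh (dist p q) * cosh (dist z w) =
      sinh (dist p q - t) * cosh (dist p w) + sinh t * cosh (dist q w)) :
    dist z q = dist p q - t := by
  have hS : 0 < sinh (dist p q) := Real.sinh_pos_iff.2 (dist_pos.2 hne)
  refine cosh_inj_nonneg dist_nonneg (by linarith) ?_
  have h1 := h q
  rw [dist_self, cosh_zero] at h1
  refine mul_left_cancel₀ hS.ne' ?_
  rw [h1, Real.sinh_sub, Real.cosh_sub]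
  linear_combination (-sinh t) * Real.cosh_sq (dist p q)

/-- Variational characterization of the foot point. -/
def Foot (K : Set ℍ) (x p : ℍ) : Prop :=
  p ∈ K ∧ ∀ q ∈ K, cosh (dist x p) * cosh (dist p q) ≤ cosh (dist x q)

lemma exists_foot {K : Set ℍ} (hK : IsCompact K) (hc : HypConvex K) (hne : K.Nonempty) (x : ℍ) :
    ∃ p, Foot K x p := by
  obtain ⟨p, hpK, hp⟩ := hK.exists_isMinOn hne (f := fun y => dist x y) (by fun_prop)
  refine ⟨p, hpK, fun q hq => ?_⟩
  by_cases hpq : p = q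
  · subst hpq; simp
  obtain ⟨r, -, hr⟩ := exists_geod p q hpq
  set D := dist p q with hD
  have hDpos : 0 < D := dist_pos.2 hpq
  have hS : 0 < sinh D := Real.sinh_pos_iff.2 hDpos
  have key : ∀ s ∈ Set.Ioo 0 D, cosh (dist x p) * cosh D -
      cosh (dist x p) * sinh D * sinh s ≤ cosh (dist x q) := by
    intro s hs
    have hrK : r s ∈ K := by
      refine hc p hpK q hq _ ?_
      rw [geod_dist_left hpq hs.1.le (hr s), geod_dist_right hpq hs.2.le (hr s)]
      ring
    have h1 : cosh (dist x p) ≤ cosh (dist x (r s)) := by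
      rw [Real.cosh_le_cosh, abs_of_nonneg dist_nonneg, abs_of_nonneg dist_nonneg]
      exact hp hrK
    have h2 := hr s x
    rw [dist_comm _ x, dist_comm _ x, dist_comm _ x, Real.sinh_sub] at h2
    have h3 := mul_le_mul_of_nonneg_left h1 hS.le
    rw [h2] at h3
    have hs0 : 0 < sinh s := Real.sinh_pos_iff.2 hs.1
    have h4 : cosh s - 1 ≤ sinh s ^ 2 := by
      have := Real.cosh_sq s
      have := Real.one_le_cosh s
      nlinarith
    have hA := Real.cosh_pos (dist x p)
    have h5 := mul_le_mul_of_nonneg_left h4 (mul_pos hA hS).le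
    refine le_of_mul_le_mul_left ?_ hs0
    nlinarith
  have hlim : Filter.Tendsto (fun s => cosh (dist x p) * cosh D -
      cosh (dist x p) * sinh D * sinh s) (nhdsWithin 0 (Set.Ioi 0))
      (nhds (cosh (dist x p) * cosh D)) := by
    have : Continuous (fun s => cosh (dist x p) * cosh D -
      cosh (dist x p) * sinh D * sinh s) := by fun_prop
    have h := (this.tendsto 0).mono_left (nhdsWithin_le_nhds (s := Set.Ioi (0:ℝ)))
    simpa using h
  refine le_of_tendsto hlim ?_
  filter_upwards [Ioo_mem_nhdsGT hDpos] with s hs using key s hs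

lemma Foot.unique {K : Set ℍ} {x p q : ℍ} (hp : Foot K x p) (hq : Foot K x q) : p = q := by
  have h1 := hp.2 q hq.1
  have h2 := hq.2 p hp.1
  have := Real.cosh_pos (dist x p)
  rw [dist_comm q p] at h2
  have hC := Real.one_le_cosh (dist p q)
  have hA := Real.one_le_cosh (dist x p)
  have hA' := Real.one_le_cosh (dist x q)
  have h3 : cosh (dist p q) = cosh 0 := by
    rw [cosh_zero]; nlinarith
  exact dist_eq_zero.1 (cosh_inj_nonneg dist_nonneg le_rfl h3)

lemma algebra_ineq {A A' E E' C Z s t : ℝ} (hA : 1 ≤ A) (hE' : 1 ≤ E') (hC : 1 < C)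
    (hU : A * C ≤ A') (hV : E' * C ≤ E)
    (hs : s ^ 2 = (1 - C ^ 2) - A ^ 2 - A' ^ 2 + 2 * A * A' * C)
    (ht : t ^ 2 = (1 - C ^ 2) - E ^ 2 - E' ^ 2 + 2 * E * E' * C)
    (hst : s * t = Z * (1 - C ^ 2) - A * (E - C * E') + A' * (E * C - E')) : C ≤ Z := by
  obtain ⟨U, rfl⟩ : ∃ U, A' = U + A * C := ⟨A' - A * C, by ring⟩
  obtain ⟨V, rfl⟩ : ∃ V, E = V + E' * C := ⟨E - E' * C, by ring⟩
  have hU0 : 0 ≤ U := by linarith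
  have hV0 : 0 ≤ V := by linarith
  have hk : 0 < C ^ 2 - 1 := by nlinarith
  set k := C ^ 2 - 1 with hkdef
  obtain ⟨a, ha0, ha⟩ : ∃ a, 0 ≤ a ∧ a ^ 2 = A ^ 2 - 1 :=
    ⟨√(A ^ 2 - 1), Real.sqrt_nonneg _, Real.sq_sqrt (by nlinarith)⟩
  obtain ⟨b, hb0, hb⟩ : ∃ b, 0 ≤ b ∧ b ^ 2 = E' ^ 2 - 1 :=
    ⟨√(E' ^ 2 - 1), Real.sqrt_nonneg _, Real.sq_sqrt (by nlinarith)⟩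
  have hs' : s ^ 2 = a ^ 2 * k - U ^ 2 := by rw [hs, ha, hkdef]; ring
  have ht' : t ^ 2 = b ^ 2 * k - V ^ 2 := by rw [ht, hb, hkdef]; ring
  have hZ : Z * k = (A * V + U * E' + A * E' * C) * k + C * U * V - s * t := by
    rw [hst, hkdef]; ring
  have hUV : U * V ≤ a * b * k := by
    refine abs_le_of_sq_le_sq' ?_ (by positivity) |>.2
    have h1 : U ^ 2 ≤ a ^ 2 * k := by nlinarith [sq_nonneg s]
    have h2 : V ^ 2 ≤ b ^ 2 * k := by nlinarith [sq_nonneg t]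
    calc (U * V) ^ 2 = U ^ 2 * V ^ 2 := by ring
      _ ≤ (a ^ 2 * k) * (b ^ 2 * k) := by gcongr
      _ = _ := by ring
  have hst2 : s * t ≤ a * b * k - U * V := by
    refine abs_le_of_sq_le_sq' ?_ (by linarith) |>.2
    have h1 : (s * t) ^ 2 = (a ^ 2 * k - U ^ 2) * (b ^ 2 * k - V ^ 2) := by
      rw [← hs', ← ht']; ring
    rw [h1]
    nlinarith [mul_nonneg hk.le (sq_nonneg (a * V - b * U))]
  have hab : a * b ≤ A * E' - 1 := by
    refine abs_le_of_sq_le_sq' ?_ (by nlinarith) |>.2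
    rw [mul_pow, ha, hb]
    nlinarith [sq_nonneg (A - E')]
  have h6 : C * k ≤ Z * k := by
    have h7 : 0 ≤ A * V + U * E' := by positivity
    have h8 : 0 ≤ (A * V + U * E') * k := by positivity
    have h9 : 0 ≤ C * U * V := by positivity
    have h10 : 0 ≤ U * V := by positivity
    have h11 : C ≤ A * E' * C - a * b := by
      have : 0 ≤ a * b := by positivity
      nlinarith
    have h12 := mul_le_mul_of_nonneg_right h11 hk.le
    rw [hZ]
    clear_value k
    linarith
  exact le_of_mul_le_mul_right h6 hk

/-- Determinant of three points in light-cone coordinates. -/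
def det3 (x p q : ℍ) : ℝ :=
  ea x * (eb p * ec q - ec p * eb q) - eb x * (ea p * ec q - ec p * ea q)
    + ec x * (ea p * eb q - eb p * ea q)

lemma gram_raw (x y p q : ℍ) : (det3 x p q / 2) * (det3 y p q / 2) =
    cosh (dist x y) * (1 - cosh (dist p q) ^ 2)
      - cosh (dist x p) * (cosh (dist y p) - cosh (dist p q) * cosh (dist y q))
      + cosh (dist x q) * (cosh (dist y p) * cosh (dist p q) - cosh (dist y q)) := by
  have h1 : (1 : ℝ) - cosh (dist p q) ^ 2 =
      (ea p * eb p - ec p ^ 2) * (ea q * eb q - ec q ^ 2) - cosh (dist p q) ^ 2 := by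
    rw [e_norm, e_norm]; ring
  have h2 : cosh (dist y p) - cosh (dist p q) * cosh (dist y q) =
      cosh (dist y p) * (ea q * eb q - ec q ^ 2) - cosh (dist p q) * cosh (dist y q) := by
    rw [e_norm]; ring
  have h3 : cosh (dist y p) * cosh (dist p q) - cosh (dist y q) =
      cosh (dist y p) * cosh (dist p q) - cosh (dist y q) * (ea p * eb p - ec p ^ 2) := by
    rw [e_norm]; ring
  rw [h1, h2, h3]
  simp only [cosh_eq, det3]
  ring

lemma Foot.dist_le {K : Set ℍ} {x y p q : ℍ} (hp : Foot K x p) (hq : Foot K y q) :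
    dist p q ≤ dist x y := by
  by_cases hpq : p = q
  · subst hpq; simp
  have h1 := hp.2 q hq.1
  have h2 := hq.2 p hp.1
  rw [dist_comm q p] at h2
  have hC : 1 < cosh (dist p q) := Real.one_lt_cosh.2 (dist_pos.2 hpq).ne'
  have hs := gram_raw x x p q
  have ht := gram_raw y y p q
  have hst := gram_raw x y p q
  rw [dist_self, cosh_zero] at hs ht
  have := algebra_ineq (Real.one_le_cosh (dist x p)) (Real.one_le_cosh (dist y q)) hC h1 h2
    (s := det3 x p q / 2) (t := det3 y p q / 2) (Z := cosh (dist x y))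
    (by rw [sq, hs]; ring) (by rw [sq, ht]; ring) hst
  rw [Real.cosh_le_cosh, abs_of_nonneg dist_nonneg, abs_of_nonneg dist_nonneg] at this
  exact this

lemma crossing {L : Set ℍ} {r : ℝ → ℍ} (hr : Continuous r) {T : ℝ} (hT : 0 ≤ T)
    (h0 : r 0 ∈ L) (h1 : r T ∉ L) : ∃ t, 0 ≤ t ∧ r t ∈ frontier L := by
  by_contra hcon
  push Not at hcon
  have hpre : IsPreconnected (r '' Set.Icc 0 T) := isPreconnected_Icc.image _ hr.continuousOn
  have hd : Disjoint (r '' Set.Icc 0 T) (frontier L) := by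
    rw [Set.disjoint_left]
    rintro _ ⟨t, ht, rfl⟩
    exact hcon t ht.1
  have hcov : r '' Set.Icc 0 T ⊆ interior L ∪ (closure L)ᶜ := by
    intro z hz
    by_contra hz2
    simp only [Set.mem_union, Set.mem_compl_iff, not_or, not_not] at hz2
    exact Set.disjoint_left.1 hd hz ⟨hz2.2, hz2.1⟩
  have m0 : r 0 ∈ r '' Set.Icc 0 T := ⟨0, ⟨le_rfl, hT⟩, rfl⟩
  have m1 : r T ∈ r '' Set.Icc 0 T := ⟨T, ⟨hT, le_rfl⟩, rfl⟩
  obtain ⟨z, -, hz1, hz2⟩ := hpre (interior L) (closure L)ᶜ isOpen_interior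
    isClosed_closure.isOpen_compl hcov
    ⟨r 0, m0, (hcov m0).resolve_right fun h => h (subset_closure h0)⟩
    ⟨r T, m1, (hcov m1).resolve_left fun h => h1 (interior_subset h)⟩
  exact hz2 (subset_closure (interior_subset hz1))

lemma hausdorff_frontier_le {K L : Set ℍ} (hK : IsCompact K) (hc : HypConvex K)
    (hne : K.Nonempty) (hL : IsCompact L) (hKL : K ⊆ L) :
    μH[1] (frontier K) ≤ μH[1] (frontier L) := by
  choose P hP using exists_foot hK hc hne
  have hlip : LipschitzWith 1 P := LipschitzWith.of_dist_le_mul fun x y => by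
    simpa using (hP x).dist_le (hP y)
  have hLf : IsCompact (frontier L) :=
    hL.of_isClosed_subset isClosed_frontier hL.isClosed.frontier_subset
  have hray : ∀ x, x ∉ K → P x ∈ P '' frontier L := by
    intro x hx
    have hne' : P x ≠ x := fun h => hx (h ▸ (hP x).1)
    obtain ⟨r, hrc, hr⟩ := exists_geod (P x) x hne'
    have hS : 0 < sinh (dist (P x) x) := Real.sinh_pos_iff.2 (dist_pos.2 hne')
    have hdist : ∀ t, 0 ≤ t → dist (P x) (r t) = t := fun t ht => geod_dist_left hne' ht (hr t)
    have h0 : r 0 = P x := by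
      have := hdist 0 le_rfl
      exact (dist_eq_zero.1 this).symm
    obtain ⟨R, hR⟩ := hL.isBounded.subset_closedBall (P x)
    have hT : r (max R 0 + 1) ∉ L := by
      intro h
      have h1 := hR h
      rw [mem_closedBall, dist_comm, hdist _ (by positivity)] at h1
      linarith [le_max_left R 0]
    obtain ⟨t, ht, htL⟩ := crossing hrc (by positivity) (h0 ▸ hKL (hP x).1) hT
    refine ⟨r t, htL, (hP (r t)).unique ⟨(hP x).1, fun q hq => ?_⟩⟩
    have hst : 0 ≤ sinh t := Real.sinh_nonneg_iff.2 ht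
    have e1 := hr t (P x)
    have e2 := hr t q
    have e3 := (hP x).2 q hq
    rw [dist_self, cosh_zero] at e1
    refine le_of_mul_le_mul_left ?_ hS
    rw [e2, ← mul_assoc, e1]
    nlinarith [mul_le_mul_of_nonneg_left e3 hst]
  have hsub : frontier K ⊆ P '' frontier L := by
    intro x hx
    have hcl : IsClosed (P '' frontier L) := (hLf.image hlip.continuous).isClosed
    rw [← hcl.closure_eq]
    have hxK : x ∈ K := hK.isClosed.frontier_subset hx
    have hPx : P x = x := by
      refine (hP x).unique ⟨hxK, fun q _ => ?_⟩
      simp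
    rw [frontier_eq_closure_inter_closure] at hx
    have h2 := image_closure_subset_closure_image hlip.continuous (Set.mem_image_of_mem P hx.2)
    rw [hPx] at h2
    refine closure_mono ?_ h2
    rintro _ ⟨z, hz, rfl⟩
    exact hray z hz
  calc μH[1] (frontier K) ≤ μH[1] (P '' frontier L) := measure_mono hsub
    _ ≤ _ := by simpa using hlip.hausdorffMeasure_image_le zero_le_one (frontier L)

lemma sphere_finite (c : ℍ) {R : ℝ} (hR : 0 ≤ R) : μH[1] (sphere c R) < ⊤ := by
  set c' : ℂ := (c.center R : ℂ) with hc'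
  set ρ : ℝ := c.im * sinh R with hρ
  have hρ0 : 0 ≤ ρ := mul_nonneg c.im_pos.le (Real.sinh_nonneg_iff.2 hR)
  set m : ℝ := c.im * exp (-R) with hm
  have hm0 : 0 < m := mul_pos c.im_pos (Real.exp_pos _)
  have him : ∀ θ : ℝ, m ≤ (circleMap c' ρ θ).im := by
    intro θ
    have h1 : circleMap c' ρ θ ∈ sphere c' ρ := circleMap_mem_sphere _ hρ0 _
    have h2 : |(circleMap c' ρ θ - c').im| ≤ ρ := by
      rw [mem_sphere, Complex.dist_eq] at h1
      exact (Complex.abs_im_le_norm _).trans h1.le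
    have h3 : c'.im = c.im * cosh R := by
      rw [hc', UpperHalfPlane.coe_im, UpperHalfPlane.center_im]
    rw [Complex.sub_im, h3] at h2
    have h4 := (abs_le.1 h2).1
    rw [hm, ← Real.cosh_sub_sinh]
    linarith
  set f : ℝ → ℍ := fun θ => UpperHalfPlane.mk (circleMap c' ρ θ) (hm0.trans_le (him θ)) with hf
  have hlip : LipschitzWith (Real.toNNReal (ρ / m)) f := by
    refine LipschitzWith.of_dist_le_mul fun x y => ?_
    rw [Real.coe_toNNReal _ (by positivity)]
    refine (UpperHalfPlane.dist_le_dist_coe_div_sqrt _ _).trans ?_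
    have h1 : dist (circleMap c' ρ x) (circleMap c' ρ y) ≤ ρ * dist x y := by
      simpa [abs_of_nonneg hρ0] using (lipschitzWith_circleMap c' ρ).dist_le_mul x y
    have h2 : m ≤ √((f x).im * (f y).im) := by
      refine Real.le_sqrt_of_sq_le ?_
      rw [sq]
      exact mul_le_mul (him x) (him y) hm0.le (hm0.le.trans (him x))
    calc dist (f x : ℂ) (f y) / √((f x).im * (f y).im) ≤ (ρ * dist x y) / m := by
          apply div_le_div₀ (by positivity) h1 hm0 h2
      _ = _ := by ring
  have hsub : sphere c R ⊆ f '' Set.Ioc 0 (2 * π) := by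
    intro z hz
    have h1 : (z : ℂ) ∈ sphere c' |ρ| := by
      rw [abs_of_nonneg hρ0, hc', hρ, ← UpperHalfPlane.image_coe_sphere]
      exact ⟨z, hz, rfl⟩
    rw [← image_circleMap_Ioc] at h1
    obtain ⟨θ, hθ, h⟩ := h1
    exact ⟨θ, hθ, UpperHalfPlane.ext h⟩
  refine (measure_mono hsub).trans_lt ?_
  refine (hlip.hausdorffMeasure_image_le zero_le_one _).trans_lt ?_
  rw [hausdorffMeasure_real, Real.volume_Ioc]
  exact ENNReal.mul_lt_top (by simp) ENNReal.ofReal_lt_top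

lemma frontier_finite {K : Set ℍ} (hK : IsCompact K) (hc : HypConvex K)
    (hne : K.Nonempty) : μH[1] (frontier K) < ⊤ := by
  obtain ⟨x, hx⟩ := hne
  obtain ⟨R, hR⟩ := hK.isBounded.subset_closedBall x
  have hR0 : 0 ≤ R := by simpa using hR hx
  refine (hausdorff_frontier_le hK hc ⟨x, hx⟩ (isCompact_closedBall x R) hR).trans_lt ?_
  exact (measure_mono frontier_closedBall_subset_sphere).trans_lt (sphere_finite x hR0)

end HypProj

end

/-- Monotonicity of perimeter for compact geodesically convex sets in the
hyperbolic plane. -/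
theorem perimeter_monotone_hyperbolic (K L : Set ℍ)
    (hKcomp : IsCompact K) (hKconv : HypConvex K) (hKint : (interior K).Nonempty)
    (hLcomp : IsCompact L) (hLconv : HypConvex L) (hLint : (interior L).Nonempty)
    (hKL : K ⊆ L) :
    hypPerim K ≤ hypPerim L := by
  have hK := hKint.mono interior_subset
  exact ENNReal.toReal_mono
    (HypProj.frontier_finite hLcomp hLconv (hLint.mono interior_subset)).ne
    (HypProj.hausdorff_frontier_le hKcomp hKconv hK hLcomp hKL)
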